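/- Let X be a local dendrite containing at least one simple closed curve, and let D ⊆ X be the union of all arcs in X both of whose endpoints lie on simple closed curves of X. Then D is a subcontinuum of X containing every simple closed curve of X, and D is contained in every subcontinuum of X that contains every simple closed curve of X; that is, D is the smallest subcontinuum of X containing all the simple closed curves of X. -/

import Mathlib

open Topology

/-- A continuum: a nonempty compact connected metrizable topological space. -/
def IsContinuum (X : Type*) [TopologicalSpace X] : Prop :=
  Nonempty X ∧ CompactSpace X ∧ ConnectedSpace X ∧ TopologicalSpace.MetrizableSpace X

/-- A simple closed curve in `X`: a subspace homeomorphic to the circle. -/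
def IsSimpleClosedCurve {X : Type*} [TopologicalSpace X] (S : Set X) : Prop :=
  Nonempty (S ≃ₜ AddCircle (1 : ℝ))

/-- A dendrite: a locally connected continuum containing no simple closed curve. -/
def IsDendrite (X : Type*) [TopologicalSpace X] : Prop :=
  IsContinuum X ∧ LocallyConnectedSpace X ∧ ∀ S : Set X, ¬ IsSimpleClosedCurve S

/-- A local dendrite: a continuum each of whose points has a neighborhood
that is a dendrite. -/
def IsLocalDendrite (X : Type*) [TopologicalSpace X] : Prop :=
  IsContinuum X ∧ ∀ x : X, ∃ N : Set X, N ∈ 𝓝 x ∧ IsDendrite N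

/-- A branch point of `X`: a point whose complement has at least three
connected components. -/
def IsBranchPoint {X : Type*} [TopologicalSpace X] (x : X) : Prop :=
  ∃ u v w : ConnectedComponents (↥({x}ᶜ : Set X)), u ≠ v ∧ u ≠ w ∧ v ≠ w

/-- `X ∖ {x}` has countably infinitely many connected components
(i.e. there are ℵ₀ branches at `x`). -/
def HasAlephNullBranchesAt (X : Type*) [TopologicalSpace X] (x : X) : Prop :=
  Countable (ConnectedComponents (↥({x}ᶜ : Set X))) ∧
    Infinite (ConnectedComponents (↥({x}ᶜ : Set X)))

/-- An arc in `X` with endpoints `a` and `b`: a subspace homeomorphic to `[0,1]`,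
with `a` and `b` the images of `0` and `1`. -/
def IsArcWithEndpoints {X : Type*} [TopologicalSpace X] (A : Set X) (a b : X) : Prop :=
  ∃ e : unitInterval ≃ₜ A, (e 0 : X) = a ∧ (e 1 : X) = b

section Peano

open Set Metric Filter

/-- In a preconnected set, any two points are joined by an eventually constant sequence
with arbitrarily small jumps. -/
lemma IsPreconnected.exists_chain {X : Type*} [PseudoMetricSpace X] {C : Set X}
    (hC : IsPreconnected C) {δ : ℝ} (hδ : 0 < δ) {a b : X} (ha : a ∈ C) (hb : b ∈ C) :
    ∃ (m : ℕ) (g : ℕ → X), g 0 = a ∧ (∀ j, m ≤ j → g j = b) ∧ (∀ j, g j ∈ C) ∧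
      ∀ j, dist (g j) (g (j + 1)) < δ := by
  have key : Relation.ReflTransGen (fun u v => v ∈ C ∧ dist u v < δ) a b := by
    refine hC.induction₂' (P := Relation.ReflTransGen (fun u v => v ∈ C ∧ dist u v < δ))
      (fun x hx => ?_) (fun x y z _ _ _ h₁ h₂ => h₁.trans h₂) ha hb
    filter_upwards [self_mem_nhdsWithin, mem_nhdsWithin_of_mem_nhds (ball_mem_nhds x hδ)]
      with y hy hxy
    rw [mem_ball] at hxy
    exact ⟨.single ⟨hy, by rwa [dist_comm]⟩, .single ⟨hx, hxy⟩⟩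
  clear hb
  induction key with
  | refl => exact ⟨0, fun _ => a, rfl, fun _ _ => rfl, fun _ => ha, fun _ => by simpa⟩
  | @tail b c _ hbc ih =>
    obtain ⟨m, g, h0, hm, hgC, hg⟩ := ih
    refine ⟨m + 1, fun j => if j ≤ m then g j else c, by simpa, fun j hj => ?_, fun j => ?_,
      fun j => ?_⟩
    · simp [show ¬ j ≤ m by omega]
    · dsimp only
      split_ifs
      exacts [hgC j, hbc.1]
    · dsimp only
      split_ifs with h₁ h₂ h₂
      · exact hg j
      · rw [hm j (by omega)]; exact hbc.2
      · omega
      · simpa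

lemma exists_chain_refinement {X : Type*} [PseudoMetricSpace X] {δ δ' ε : ℝ}
    (h : ∀ a b : X, dist a b < δ → ∃ C, IsPreconnected C ∧ a ∈ C ∧ b ∈ C ∧ C ⊆ ball a ε)
    (hδ' : 0 < δ') (hε : 0 < ε) (c : ℕ → X) (k : ℕ) (hc : ∀ i, dist (c i) (c (i + 1)) < δ)
    (hk : ∀ i, k ≤ i → c i = c k) :
    ∃ (m : ℕ) (c' : ℕ → X), 0 < m ∧ (∀ i, dist (c' i) (c' (i + 1)) < δ') ∧
      (∀ i, k * m ≤ i → c' i = c k) ∧ c' 0 = c 0 ∧ ∀ i, dist (c' i) (c (i / m)) < ε := by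
  have step (i : ℕ) : ∃ (m : ℕ) (g : ℕ → X), g 0 = c i ∧ (∀ j, m ≤ j → g j = c (i + 1)) ∧
      (∀ j, g j ∈ ball (c i) ε) ∧ (∀ j, dist (g j) (g (j + 1)) < δ') ∧
      (k ≤ i → ∀ j, g j = c k) := by
    by_cases hi : k ≤ i
    · refine ⟨0, fun _ => c k, (hk i hi).symm, fun _ _ => (hk _ (by omega)).symm, fun _ => ?_,
        fun _ => by simpa, fun _ _ => rfl⟩
      rw [hk i hi]
      exact mem_ball_self hε
    · obtain ⟨C, hC, ha, hb, hCb⟩ := h _ _ (hc i)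
      obtain ⟨m, g, h0, hm, hgC, hg⟩ := hC.exists_chain hδ' ha hb
      exact ⟨m, g, h0, hm, fun j => hCb (hgC j), hg, fun h => absurd h hi⟩
  choose m g h0 hm hball hg hconst using step
  obtain ⟨M, hM⟩ : ∃ M, ∀ i < k, m i ≤ M :=
    ⟨(Finset.range k).sup m, fun i hi => Finset.le_sup (by simpa using hi)⟩
  refine ⟨M + 1, fun i => g (i / (M + 1)) (i % (M + 1)), by omega, fun i => ?_, fun i hi => ?_,
    by simp [h0], fun i => hball _ _⟩
  · dsimp only
    obtain ⟨q, hq⟩ : ∃ q, i / (M + 1) = q := ⟨_, rfl⟩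
    obtain ⟨r, hr⟩ : ∃ r, i % (M + 1) = r := ⟨_, rfl⟩
    have hM0 : 0 < M + 1 := by omega
    obtain ⟨hi, hrM⟩ := (Nat.div_mod_unique hM0).1 ⟨hq, hr⟩
    rw [hq, hr]
    rcases Nat.lt_or_ge r M with h | h
    · obtain ⟨h₁, h₂⟩ := (Nat.div_mod_unique (a := i + 1) (c := r + 1) (d := q) hM0).2
        ⟨by omega, by omega⟩
      rw [h₁, h₂]
      exact hg q r
    · obtain ⟨h₁, h₂⟩ := (Nat.div_mod_unique (a := i + 1) (c := 0) (d := q + 1) hM0).2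
        ⟨by rw [mul_add]; omega, by omega⟩
      rw [h₁, h₂, h0]
      have : g q r = c (q + 1) := by
        by_cases hqk : k ≤ q
        · rw [hconst q hqk, hk (q + 1) (by omega)]
        · exact hm q r ((hM q (by omega)).trans h)
      simpa [this]
  · exact hconst _ ((Nat.le_div_iff_mul_le (by omega)).2 hi) _

/-- In a complete uniformly locally connected metric space, close points are joined
by small paths. -/
lemma exists_joinedIn_of_uniformly_locally_connected {X : Type*} [MetricSpace X]
    [CompleteSpace X]
    (h : ∀ ε > 0, ∃ δ > 0, ∀ a b : X, dist a b < δ →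
      ∃ C, IsPreconnected C ∧ a ∈ C ∧ b ∈ C ∧ C ⊆ ball a ε) {ε : ℝ} (hε : 0 < ε) :
    ∃ δ > 0, ∀ x y : X, dist x y < δ → JoinedIn (ball x ε) x y := by
  obtain ⟨η, hη, rfl⟩ : ∃ η > 0, ε = 3 * η := ⟨ε / 3, by positivity, by ring⟩
  have hpos (n : ℕ) : 0 < η / 2 / 2 ^ n := by positivity
  choose δ₀ hδ₀ hC₀ using fun n => h _ (hpos n)
  set δ : ℕ → ℝ := fun n => min (δ₀ n) (η / 2 / 2 ^ n) with hδdef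
  have hδ (n : ℕ) : 0 < δ n := lt_min (hδ₀ n) (hpos n)
  have hδle (n : ℕ) : δ n ≤ η / 2 / 2 ^ n := min_le_right _ _
  have hC (n : ℕ) (a b : X) (hab : dist a b < δ n) :=
    hC₀ n a b (hab.trans_le (min_le_left _ _))
  refine ⟨δ 0, hδ 0, fun x y hxy => ?_⟩
  let Good (n : ℕ) (s : (ℕ → X) × ℕ) : Prop :=
    0 < s.2 ∧ (∀ i, dist (s.1 i) (s.1 (i + 1)) < δ n) ∧ (∀ i, s.2 ≤ i → s.1 i = y) ∧ s.1 0 = x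
  have step (n : ℕ) (s : {s // Good n s}) : ∃ s' : {s // Good (n + 1) s}, ∃ m > 0,
      s'.1.2 = s.1.2 * m ∧ ∀ i, dist (s'.1.1 i) (s.1.1 (i / m)) < η / 2 / 2 ^ n := by
    obtain ⟨⟨c, k⟩, hk, hc, hy, hx⟩ := s
    obtain ⟨m, c', hm, hc', hk', hx', hcc'⟩ := exists_chain_refinement (hC n) (hδ (n + 1))
      (hpos n) c k hc (fun i hi => (hy i hi).trans (hy k le_rfl).symm)
    exact ⟨⟨⟨c', k * m⟩, Nat.mul_pos hk hm, hc', fun i hi => (hk' i hi).trans (hy k le_rfl),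
      hx'.trans hx⟩, m, hm, rfl, hcc'⟩
  choose next m hm hnext_k hnext_dist using step
  let s (n : ℕ) : {s // Good n s} := Nat.rec
    ⟨⟨fun i => if i = 0 then x else y, 1⟩, by simp, fun i => by
      rcases i with _ | i
      · simpa using hxy
      · simpa using hδ 0, fun i hi => if_neg (by omega), by simp⟩ next n
  let k (n : ℕ) : ℕ := (s n).1.2
  let c (n : ℕ) : ℕ → X := (s n).1.1
  have hk (n : ℕ) : 0 < k n := (s n).2.1
  have hc (n : ℕ) : ∀ i, dist (c n i) (c n (i + 1)) < δ n := (s n).2.2.1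
  let f (n : ℕ) (t : ℝ) : X := c n ⌊t * k n⌋₊
  have hf (t : ℝ) (n : ℕ) : dist (f n t) (f (n + 1) t) ≤ η / 2 / 2 ^ n := by
    have h₁ : ⌊t * k (n + 1)⌋₊ / m n (s n) = ⌊t * k n⌋₊ := by
      rw [← Nat.floor_div_natCast]
      congr 1
      have : (0 : ℝ) < m n (s n) := by exact_mod_cast hm n (s n)
      have h₂ : (k (n + 1) : ℝ) = k n * m n (s n) := by exact_mod_cast hnext_k n (s n)
      rw [h₂]
      field_simp
    have := hnext_dist n (s n) ⌊t * k (n + 1)⌋₊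
    rw [h₁, dist_comm] at this
    exact this.le
  choose F hF using fun t =>
    cauchySeq_tendsto_of_complete (cauchySeq_of_le_geometric_two (hf t))
  have hdist (t : ℝ) (n : ℕ) : dist (f n t) (F t) ≤ η / 2 ^ n :=
    dist_le_of_le_geometric_two_of_tendsto (hf t) (hF t) n
  have hfloor (n : ℕ) (t u : ℝ) (htu : t ≤ u) (hut : u - t < 1 / k n) :
      dist (f n t) (f n u) ≤ η / 2 / 2 ^ n := by
    have hkn : (0 : ℝ) < k n := by exact_mod_cast hk n
    have h₁ : ⌊t * k n⌋₊ ≤ ⌊u * k n⌋₊ := Nat.floor_mono (by gcongr)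
    have h₂ : ⌊u * k n⌋₊ ≤ ⌊t * k n⌋₊ + 1 := by
      rw [lt_div_iff₀ hkn] at hut
      have h₃ := Nat.lt_floor_add_one (t * k n)
      refine Nat.lt_succ_iff.1 ((Nat.floor_lt' (by omega)).2 ?_)
      push_cast
      linarith
    obtain h | h : ⌊u * k n⌋₊ = ⌊t * k n⌋₊ ∨ ⌊u * k n⌋₊ = ⌊t * k n⌋₊ + 1 := by omega
    · simp only [f, h, dist_self]
      exact (hpos n).le
    · simp only [f, h]
      exact (hc n _).le.trans (hδle n)
  have hcont : Continuous F := by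
    rw [Metric.continuous_iff]
    intro t ε hε
    obtain ⟨n, hn⟩ : ∃ n : ℕ, 3 * η / 2 ^ n < ε := by
      obtain ⟨n, hn⟩ := exists_pow_lt_of_lt_one (show 0 < ε / (3 * η) by positivity)
        (show (1 / 2 : ℝ) < 1 by norm_num)
      refine ⟨n, ?_⟩
      rw [lt_div_iff₀ (by positivity), one_div, inv_pow] at hn
      rw [div_eq_inv_mul]
      exact hn
    have hkn : (0 : ℝ) < k n := by exact_mod_cast hk n
    refine ⟨1 / k n, by positivity, fun u hu => lt_of_le_of_lt ?_ hn⟩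
    have h₁ : dist (f n u) (f n t) ≤ η / 2 / 2 ^ n := by
      rw [Real.dist_eq, abs_lt] at hu
      rcases le_total u t with h | h
      · exact hfloor n u t h (by linarith)
      · rw [dist_comm]
        exact hfloor n t u h (by linarith)
    have h₂ : η / 2 / 2 ^ n ≤ η / 2 ^ n := by gcongr; linarith
    have h₃ : 3 * η / 2 ^ n = η / 2 ^ n + η / 2 ^ n + η / 2 ^ n := by ring
    have h₄ := dist_triangle4 (F u) (f n u) (f n t) (F t)
    have h₅ := hdist u n
    have h₆ := hdist t n
    rw [dist_comm] at h₅
    linarith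
  have hend {t : ℝ} {z : X} (h : ∀ n, f n t = z) : F t = z := by
    have h₁ := hF t
    simp only [h] at h₁
    exact tendsto_nhds_unique h₁ tendsto_const_nhds
  refine JoinedIn.ofLine hcont.continuousOn (hend fun n => ?_) (hend fun n => ?_) ?_
  · simpa [f] using (s n).2.2.2.2
  · simpa [f] using (s n).2.2.2.1 _ le_rfl
  · rintro _ ⟨t, -, rfl⟩
    have h₁ : dist (f 0 t) x < η := by
      have h₂ : f 0 t = if ⌊t * k 0⌋₊ = 0 then x else y := rfl
      rw [h₂]
      split_ifs
      · simpa
      · rw [dist_comm]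
        have := hδle 0
        norm_num at this
        linarith
    have h₂ := hdist t 0
    rw [dist_comm, pow_zero, div_one] at h₂
    have := dist_triangle (F t) (f 0 t) x
    rw [mem_ball]
    linarith

/-- A compact, locally connected metrizable space is locally path-connected. -/
lemma LocallyConnectedSpace.locallyPathConnectedSpace {X : Type*} [TopologicalSpace X]
    [CompactSpace X] [TopologicalSpace.MetrizableSpace X] [LocallyConnectedSpace X] :
    LocallyPathConnectedSpace X := by
  let := TopologicalSpace.metrizableSpaceMetric X
  have key (ε : ℝ) (hε : 0 < ε) : ∃ δ > 0, ∀ a b : X, dist a b < δ →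
      ∃ C, IsPreconnected C ∧ a ∈ C ∧ b ∈ C ∧ C ⊆ ball a ε := by
    choose V hVb hVo hxV hVc using fun x : X =>
      locallyConnectedSpace_iff_subsets_isOpen_isConnected.1 ‹_› x _
        (ball_mem_nhds x (half_pos hε))
    obtain ⟨δ, hδ, h⟩ := lebesgue_number_lemma_of_metric (isCompact_univ (X := X)) hVo
      (fun x _ => mem_iUnion.2 ⟨x, hxV x⟩)
    refine ⟨δ, hδ, fun a b hab => ?_⟩
    obtain ⟨x, hx⟩ := h a trivial
    have ha : a ∈ V x := hx (mem_ball_self hδ)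
    refine ⟨V x, (hVc x).isPreconnected, ha, hx (by rwa [mem_ball, dist_comm]), fun z hz => ?_⟩
    have h₁ := mem_ball.1 (hVb x hz)
    have h₂ := mem_ball.1 (hVb x ha)
    have := dist_triangle_right z a x
    rw [mem_ball]
    linarith
  refine ⟨fun x => ⟨fun s => ⟨fun hs => ?_, fun ⟨t, ⟨ht, _⟩, hts⟩ => mem_of_superset ht hts⟩⟩⟩
  obtain ⟨ε, hε, hεs⟩ := Metric.mem_nhds_iff.1 hs
  obtain ⟨δ, hδ, h⟩ := exists_joinedIn_of_uniformly_locally_connected key hε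
  refine ⟨pathComponentIn (ball x ε) x, ⟨?_, ?_⟩, pathComponentIn_subset.trans hεs⟩
  · filter_upwards [ball_mem_nhds x hδ] with y hy
    rw [mem_ball, dist_comm] at hy
    exact h x y hy
  · exact isPathConnected_pathComponentIn (mem_ball_self hε)

end Peano

section PathToArc

open Set Filter unitInterval

/-- The closed sets of parameters such that `γ` takes the same value at both ends of each
complementary gap. -/
def pathSkeletons {X : Type*} [TopologicalSpace X] (γ : C(I, X)) : Set (Set I) :=
  {F | IsClosed F ∧ 0 ∈ F ∧ 1 ∈ F ∧
    ∀ a ∈ F, ∀ b ∈ F, a < b → (∀ z ∈ F, a < z → ¬ z < b) → γ a = γ b}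

lemma exists_minimal_pathSkeleton {X : Type*} [TopologicalSpace X] [T2Space X] (γ : C(I, X)) :
    ∃ F, Minimal (· ∈ pathSkeletons γ) F := by
  refine zorn_superset _ fun c hc hchain => ?_
  rcases c.eq_empty_or_nonempty with rfl | hne
  · refine ⟨univ, ⟨isClosed_univ, trivial, trivial, fun a _ b _ hab h => ?_⟩, by simp⟩
    obtain ⟨z, hz, hz'⟩ := exists_between hab
    exact absurd hz' (h z trivial hz)
  refine ⟨⋂₀ c, ⟨isClosed_sInter fun F hF => (hc hF).1, fun F hF => (hc hF).2.1,
    fun F hF => (hc hF).2.2.1, fun a ha b hb hab hgap => ?_⟩, fun F hF => sInter_subset_of_mem hF⟩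
  by_contra hne'
  obtain ⟨U, V, hU, hV, haU, hbV, hUV⟩ := t2_separation hne'
  obtain ⟨m, ham, hmb⟩ := exists_between hab
  obtain ⟨a₁, ha₁, hsubU⟩ := exists_Ico_subset_of_mem_nhds'
    ((hU.preimage γ.continuous).mem_nhds haU) ham
  obtain ⟨b₁, hb₁, hsubV⟩ := exists_Ioc_subset_of_mem_nhds'
    ((hV.preimage γ.continuous).mem_nhds hbV) hmb
  obtain ⟨a', haa', ha'⟩ := exists_between ha₁.1
  obtain ⟨b', hb', hbb'⟩ := exists_between hb₁.2
  have hab' : a' < b' := (ha'.trans_le ha₁.2).trans_le (hb₁.1.trans hb'.le)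
  obtain ⟨⟨F, hF⟩, hFI⟩ : ∃ F : c, Icc a' b' ∩ (F : Set I) = ∅ := by
    have : Nonempty c := hne.to_subtype
    refine isCompact_Icc.elim_directed_family_closed (fun F : c => (F : Set I))
      (fun F => (hc F.2).1) ?_ ?_
    · refine eq_empty_of_forall_notMem fun z ⟨hz, hz'⟩ => ?_
      rw [← sInter_eq_iInter] at hz'
      exact hgap z hz' (haa'.trans_le hz.1) (hz.2.trans_lt hbb')
    · intro F G
      rcases hchain.total F.2 G.2 with h | h
      · exact ⟨F, Subset.rfl, h⟩
      · exact ⟨G, h, Subset.rfl⟩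
  obtain ⟨hFc, -, -, hFgap⟩ := hc hF
  obtain ⟨α, ⟨hαF, hαa⟩, hα⟩ := (hFc.inter isClosed_Iic).isCompact.exists_isGreatest
    (s := F ∩ Iic a') ⟨a, ha F hF, haa'.le⟩
  obtain ⟨β, ⟨hβF, hβb⟩, hβ⟩ := (hFc.inter isClosed_Ici).isCompact.exists_isLeast
    (s := F ∩ Ici b') ⟨b, hb F hF, hbb'.le⟩
  simp only [mem_Iic, mem_Ici] at hαa hβb
  have hγ := hFgap α hαF β hβF (hαa.trans_lt (hab'.trans_le hβb)) fun z hz h₁ h₂ => by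
    rcases le_or_gt z a' with h | h
    · exact (hα ⟨hz, h⟩).not_gt h₁
    rcases le_or_gt b' z with h' | h'
    · exact (hβ ⟨hz, h'⟩).not_gt h₂
    · exact (hFI ▸ (⟨⟨h.le, h'.le⟩, hz⟩ : z ∈ Icc a' b' ∩ F) : z ∈ (∅ : Set I))
  refine disjoint_left.1 hUV (hsubU ⟨hα ⟨ha F hF, haa'.le⟩, hαa.trans_lt ha'⟩) ?_
  change γ α ∈ V
  rw [hγ]
  exact hsubV ⟨hb'.trans_le hβb, hβ ⟨hb F hF, hbb'.le⟩⟩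

lemma eq_of_minimal_pathSkeleton {X : Type*} [TopologicalSpace X] {γ : C(I, X)} {F : Set I}
    (hF : Minimal (· ∈ pathSkeletons γ) F) {s t u : I} (hs : s ∈ F) (ht : t ∈ F) (hu : u ∈ F)
    (hst : s ≤ t) (htu : t ≤ u) (h : γ s = γ u) : t = s ∨ t = u := by
  by_contra! hne
  have hst := lt_of_le_of_ne hst hne.1.symm
  have htu := lt_of_le_of_ne htu hne.2
  have hmem : F \ Ioo s u ∈ pathSkeletons γ := by
    obtain ⟨hFc, h0, h1, hgap⟩ := hF.prop
    refine ⟨hFc.sdiff isOpen_Ioo, ⟨h0, fun h => h.1.not_ge bot_le⟩,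
      ⟨h1, fun h => h.2.not_ge le_top⟩, fun a ha b hb hab hab' => ?_⟩
    by_cases hz : ∀ z ∈ F, a < z → ¬ z < b
    · exact hgap a ha.1 b hb.1 hab hz
    push Not at hz
    obtain ⟨z, hzF, haz, hzb⟩ := hz
    have hzsu : z ∈ Ioo s u := by
      by_contra hz
      exact hab' z ⟨hzF, hz⟩ haz hzb
    have h₁ : a = s := by
      refine le_antisymm ?_ ?_
      · by_contra! h
        exact ha.2 ⟨h, haz.trans hzsu.2⟩
      · by_contra! h
        exact hab' s ⟨hs, fun h => h.1.false⟩ h (hzsu.1.trans hzb)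
    have h₂ : b = u := by
      refine le_antisymm ?_ ?_
      · by_contra! h
        exact hab' u ⟨hu, fun h => h.2.false⟩ (haz.trans hzsu.2) h
      · by_contra! h
        exact hb.2 ⟨hzsu.1.trans hzb, h⟩
    rw [h₁, h₂, h]
  exact (hF.le_of_le hmem sdiff_subset ht).2 ⟨hst, htu⟩

/-- Every path can be replaced by one with the same ends whose fibres are order-convex. -/
lemma exists_path_ordConnected_fibers {X : Type*} [TopologicalSpace X] [T2Space X]
    (γ : C(I, X)) : ∃ γ' : C(I, X), γ' 0 = γ 0 ∧ γ' 1 = γ 1 ∧ range γ' ⊆ range γ ∧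
      ∀ s t u, s ≤ t → t ≤ u → γ' s = γ' u → γ' t = γ' s := by
  obtain ⟨F, hF⟩ := exists_minimal_pathSkeleton γ
  obtain ⟨hFc, h0, h1, hgap⟩ := hF.prop
  have hρ (u : I) : ∃ r, IsGreatest (F ∩ Iic u) r :=
    (hFc.inter isClosed_Iic).isCompact.exists_isGreatest ⟨0, h0, mem_Iic.2 bot_le⟩
  have hτ (u : I) : ∃ r, IsLeast (F ∩ Ici u) r :=
    (hFc.inter isClosed_Ici).isCompact.exists_isLeast ⟨1, h1, mem_Ici.2 le_top⟩
  choose ρ hρ using hρ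
  choose τ hτ using hτ
  have hρF (u : I) : ρ u ∈ F := (hρ u).1.1
  have hτF (u : I) : τ u ∈ F := (hτ u).1.1
  have hρle (u : I) : ρ u ≤ u := (hρ u).1.2
  have hτle (u : I) : u ≤ τ u := (hτ u).1.2
  have hle_ρ {u z : I} (hz : z ∈ F) (hzu : z ≤ u) : z ≤ ρ u := (hρ u).2 ⟨hz, hzu⟩
  have hτ_le {u z : I} (hz : z ∈ F) (hzu : u ≤ z) : τ u ≤ z := (hτ u).2 ⟨hz, hzu⟩
  have hρself {u : I} (hu : u ∈ F) : ρ u = u := le_antisymm (hρle u) (hle_ρ hu le_rfl)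
  have hρτ (u : I) : γ (ρ u) = γ (τ u) := by
    rcases ((hρle u).trans (hτle u)).eq_or_lt with h | h
    · rw [h]
    refine hgap _ (hρF u) _ (hτF u) h fun z hz h₁ h₂ => ?_
    rcases le_total z u with h | h
    · exact (hle_ρ hz h).not_gt h₁
    · exact (hτ_le hz h).not_gt h₂
  have hcont : Continuous fun u => γ (ρ u) := by
    rw [continuous_iff_continuousAt]
    intro u
    by_cases hu : u ∈ F
    · intro O hO
      simp only [hρself hu] at hO
      obtain ⟨s, hs, hso, hsO⟩ : ∃ s : Set I, s ∈ 𝓝 u ∧ s.OrdConnected ∧ s ⊆ γ ⁻¹' O := by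
        obtain ⟨l, r, -, hlr, hsub⟩ := exists_Icc_mem_subset_of_mem_nhds
          (γ.continuous.continuousAt.preimage_mem_nhds hO)
        exact ⟨Icc l r, hlr, ordConnected_Icc, hsub⟩
      rw [mem_map]
      filter_upwards [hs] with v hv
      rcases le_total u v with h | h
      · exact hsO (hso.out (mem_of_mem_nhds hs) hv ⟨hle_ρ hu h, hρle v⟩)
      · change γ (ρ v) ∈ O
        rw [hρτ]
        exact hsO (hso.out hv (mem_of_mem_nhds hs) ⟨hτle v, hτ_le hu h⟩)
    · refine (continuousAt_const (y := γ (ρ u))).congr ?_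
      have h₁ : ρ u < u := lt_of_le_of_ne (hρle u) fun h => hu (h ▸ hρF u)
      have h₂ : u < τ u := lt_of_le_of_ne (hτle u) fun h => hu (h ▸ hτF u)
      filter_upwards [Ioo_mem_nhds h₁ h₂] with v hv
      congr 1
      refine le_antisymm (hle_ρ (hρF u) hv.1.le) (hle_ρ (hρF v) ?_)
      by_contra! h
      exact (hτ_le (hρF v) h.le).not_gt ((hρle v).trans_lt hv.2)
  refine ⟨⟨_, hcont⟩, by simp [hρself h0], by simp [hρself h1], ?_, fun s t u hst htu h => ?_⟩
  · rintro _ ⟨u, rfl⟩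
    exact ⟨_, rfl⟩
  · have h₁ : ρ s ≤ ρ t := hle_ρ (hρF s) ((hρle s).trans hst)
    have h₂ : ρ t ≤ ρ u := hle_ρ (hρF t) ((hρle t).trans htu)
    change γ (ρ s) = γ (ρ u) at h
    change γ (ρ t) = γ (ρ s)
    rcases eq_of_minimal_pathSkeleton hF (hρF s) (hρF t) (hρF u) h₁ h₂ h with h' | h'
    · rw [h']
    · rw [h', h]

/-- A continuous monotone real function on `I` separating the fibres of a path whose fibres
are order-convex. -/
lemma exists_monotone_separating_fibers {X : Type*} [TopologicalSpace X]
    [TopologicalSpace.MetrizableSpace X] (γ : C(I, X))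
    (hγ : ∀ s t u, s ≤ t → t ≤ u → γ s = γ u → γ t = γ s) :
    ∃ h : I → ℝ, Continuous h ∧ Monotone h ∧ ∀ a b, h a = h b ↔ γ a = γ b := by
  let := TopologicalSpace.metrizableSpaceMetric X
  let φ (s v : I) : ℝ := min 1 (Metric.infDist (γ v) (γ '' Iic s))
  have hφ (s : I) : Continuous (φ s) :=
    continuous_const.min ((Metric.continuous_infDist_pt _).comp γ.continuous)
  have hφ0 (s v : I) : 0 ≤ φ s v := le_min zero_le_one Metric.infDist_nonneg
  have hφ1 (s v : I) : φ s v ≤ 1 := min_le_left _ _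
  have hφeq {s v : I} (h : v ≤ s) : φ s v = 0 := by
    simp [φ, Metric.infDist_zero_of_mem (mem_image_of_mem γ (mem_Iic.2 h))]
  let G (s u : I) : ℝ := sSup ((fun w => φ s (min w u)) '' univ)
  have hbdd (s u : I) : BddAbove ((fun w => φ s (min w u)) '' univ) :=
    ⟨1, by rintro _ ⟨w, -, rfl⟩; exact hφ1 _ _⟩
  have hG (s : I) : Continuous (G s) :=
    isCompact_univ.continuous_sSup (f := fun u w => φ s (min w u))
      ((hφ s).comp (continuous_snd.min continuous_fst))
  have hle {s u w : I} (h : w ≤ u) : φ s w ≤ G s u :=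
    le_csSup (hbdd s u) ⟨w, trivial, by simp [h]⟩
  have hGle {s u : I} {x : ℝ} (h : ∀ w ≤ u, φ s w ≤ x) : G s u ≤ x :=
    csSup_le ⟨_, u, trivial, rfl⟩ (by rintro _ ⟨w, -, rfl⟩; exact h _ (min_le_right _ _))
  have hG0 (s u : I) : 0 ≤ G s u := (hφ0 s u).trans (hle le_rfl)
  have hG1 (s u : I) : G s u ≤ 1 := hGle fun _ _ => hφ1 _ _
  have hGmono (s : I) : Monotone (G s) := fun u v huv => hGle fun w hw => hle (hw.trans huv)
  have hGfib {s u v : I} (huv : u ≤ v) (h : γ u = γ v) : G s u = G s v := by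
    refine le_antisymm (hGmono s huv) (hGle fun w hw => ?_)
    rcases le_total w u with h' | h'
    · exact hle h'
    · have : φ s w = φ s u := by simp only [φ, hγ u w v h' hw h]
      rw [this]
      exact hle le_rfl
  let d := TopologicalSpace.denseSeq I
  have hsum (u : I) : Summable fun n => (1 / 2 : ℝ) ^ n * G (d n) u :=
    Summable.of_nonneg_of_le (fun n => mul_nonneg (by positivity) (hG0 _ _))
      (fun n => mul_le_of_le_one_right (by positivity) (hG1 _ _)) summable_geometric_two
  have hmono : Monotone fun u => ∑' n, (1 / 2 : ℝ) ^ n * G (d n) u := fun u v huv =>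
    (hsum u).tsum_le_tsum (fun n => mul_le_mul_of_nonneg_left (hGmono _ huv) (by positivity))
      (hsum v)
  have hlt {a b : I} (hab : a ≤ b) (hne : γ a ≠ γ b) :
      ∑' n, (1 / 2 : ℝ) ^ n * G (d n) a < ∑' n, (1 / 2 : ℝ) ^ n * G (d n) b := by
    have hab' : a < b := lt_of_le_of_ne hab fun h => hne (h ▸ rfl)
    obtain ⟨n, hn⟩ : ∃ n, d n ∈ Ioo a b ∩ {s | γ s ≠ γ b} := by
      have hopen : IsOpen (Ioo a b ∩ {s | γ s ≠ γ b}) :=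
        isOpen_Ioo.inter (isOpen_ne_fun γ.continuous continuous_const)
      refine (TopologicalSpace.denseRange_denseSeq I).exists_mem_open hopen ?_
      have : (𝓝[>] a).NeBot := nhdsGT_neBot_of_exists_gt ⟨b, hab'⟩
      have h₁ : {s | γ s ≠ γ b} ∈ 𝓝[>] a := mem_nhdsWithin_of_mem_nhds
        ((isOpen_ne_fun γ.continuous continuous_const).mem_nhds hne)
      exact nonempty_of_mem (inter_mem (Ioo_mem_nhdsGT hab') h₁)
    have hpos : 0 < φ (d n) b := by
      refine lt_min zero_lt_one ?_
      have hcl : IsClosed (γ '' Iic (d n)) :=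
        (isClosed_Iic.isCompact.image γ.continuous).isClosed
      rw [← hcl.notMem_iff_infDist_pos ⟨_, mem_image_of_mem γ (mem_Iic.2 le_rfl)⟩]
      rintro ⟨r, hr, hrb⟩
      exact hn.2 ((hγ r (d n) b hr hn.1.2.le hrb).trans hrb)
    refine (hsum a).tsum_lt_tsum (i := n)
      (fun n => mul_le_mul_of_nonneg_left (hGmono _ hab) (by positivity)) ?_ (hsum b)
    have h₁ : G (d n) a ≤ 0 := hGle fun w hw => (hφeq (hw.trans hn.1.1.le)).le
    exact mul_lt_mul_of_pos_left ((h₁.trans_lt hpos).trans_le (hle le_rfl)) (by positivity)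
  refine ⟨_, continuous_tsum (f := fun n u => (1 / 2 : ℝ) ^ n * G (d n) u)
    (fun n => continuous_const.mul (hG (d n))) summable_geometric_two
    (fun n u => ?_), hmono, fun a b => ⟨fun h => ?_, fun h => ?_⟩⟩
  · rw [Real.norm_of_nonneg (mul_nonneg (by positivity) (hG0 _ _))]
    exact mul_le_of_le_one_right (by positivity) (hG1 _ _)
  · by_contra hne
    rcases le_total a b with hab | hab
    · exact (hlt hab hne).ne h
    · exact (hlt hab (Ne.symm hne)).ne' h
  · rcases le_total a b with hab | hab
    · simp only [hGfib hab h]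
    · simp only [hGfib hab h.symm]

/-- In a metrizable space, distinct points joined by a path are joined by an arc. -/
lemma JoinedIn.exists_injective_path {X : Type*} [TopologicalSpace X]
    [TopologicalSpace.MetrizableSpace X] {F : Set X} {x y : X} (h : JoinedIn F x y)
    (hxy : x ≠ y) : ∃ γ : Path x y, Function.Injective γ ∧ range γ ⊆ F := by
  obtain ⟨γ, h0, h1, hrange, hfib⟩ := exists_path_ordConnected_fibers h.somePath.toContinuousMap
  replace h0 : γ 0 = x := h0.trans h.somePath.source
  replace h1 : γ 1 = y := h1.trans h.somePath.target
  obtain ⟨H, hH, hmono, hHγ⟩ := exists_monotone_separating_fibers γ hfib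
  have h01 : H 0 < H 1 := lt_of_le_of_ne (hmono bot_le) fun h => by
    rw [hHγ, h0, h1] at h
    exact hxy h
  have hpos : 0 < H 1 - H 0 := sub_pos.2 h01
  let K : I → I := fun u => ⟨(H u - H 0) / (H 1 - H 0),
    div_nonneg (sub_nonneg.2 (hmono bot_le)) hpos.le,
    (div_le_one hpos).2 (sub_le_sub_right (hmono le_top) _)⟩
  have hK : Continuous K := by fun_prop
  have hKγ (a b : I) : K a = K b ↔ γ a = γ b := by
    rw [← hHγ, Subtype.ext_iff, div_left_inj' hpos.ne', sub_left_inj]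
  have hK0 : K 0 = 0 := by simp [K]
  have hK1 : K 1 = 1 := by simp [K, hpos.ne']
  have hsurj : Function.Surjective K := fun t => by
    have := intermediate_value_univ 0 1 hK
    rw [hK0, hK1] at this
    exact this ⟨bot_le, le_top⟩
  have hq : IsQuotientMap K := .of_surjective_continuous hsurj hK
  let β := hq.lift (f := ⟨K, hK⟩) γ fun a b hab => (hKγ a b).1 hab
  have hβ (u : I) : β (K u) = γ u :=
    DFunLike.congr_fun (hq.lift_comp (f := ⟨K, hK⟩) γ fun a b hab => (hKγ a b).1 hab) u
  refine ⟨⟨β, ?_, ?_⟩, fun s t hst => ?_, ?_⟩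
  · change β 0 = x
    rw [← hK0, hβ, h0]
  · change β 1 = y
    rw [← hK1, hβ, h1]
  · obtain ⟨a, rfl⟩ := hsurj s
    obtain ⟨b, rfl⟩ := hsurj t
    change β (K a) = β (K b) at hst
    rwa [hβ, hβ, ← hKγ] at hst
  · rintro _ ⟨s, rfl⟩
    obtain ⟨a, rfl⟩ := hsurj s
    obtain ⟨b, hb⟩ := hrange ⟨a, rfl⟩
    change β (K a) ∈ F
    rw [hβ, ← hb]
    exact h.somePath_mem b

end PathToArc

section Curves

open Set unitInterval

lemma Continuous.isSimpleClosedCurve_range {X : Type*} [TopologicalSpace X] [T2Space X]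
    {g : AddCircle (1 : ℝ) → X} (hg : Continuous g) (hinj : Function.Injective g) :
    IsSimpleClosedCurve (range g) :=
  ⟨(hg.isClosedEmbedding hinj).isEmbedding.toHomeomorph.symm⟩

lemma IsSimpleClosedCurve.exists_range_eq {X : Type*} [TopologicalSpace X] {S : Set X}
    (hS : IsSimpleClosedCurve S) :
    ∃ g : AddCircle (1 : ℝ) → X, Continuous g ∧ Function.Injective g ∧ range g = S := by
  obtain ⟨e⟩ := hS
  refine ⟨fun t => e.symm t, by fun_prop, Subtype.val_injective.comp e.symm.injective, ?_⟩
  change range (Subtype.val ∘ e.symm) = S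
  rw [range_comp, e.symm.surjective.range_eq, image_univ, Subtype.range_val]

lemma IsSimpleClosedCurve.exists_periodic_param {X : Type*} [TopologicalSpace X] {S : Set X}
    (hS : IsSimpleClosedCurve S) {p : X} (hp : p ∈ S) :
    ∃ f : ℝ → X, Continuous f ∧ f 0 = p ∧ range f = S ∧ Function.Periodic f 1 ∧
      ∀ s t, |s - t| < 1 → f s = f t → s = t := by
  obtain ⟨g, hg, hinj, rfl⟩ := hS.exists_range_eq
  obtain ⟨c, rfl⟩ := hp
  refine ⟨fun t => g (t + c), by fun_prop, by simp, ?_, fun t => by simp, fun s t hst h => ?_⟩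
  · refine Subset.antisymm (by rintro _ ⟨t, rfl⟩; exact ⟨_, rfl⟩) ?_
    rintro _ ⟨z, rfl⟩
    obtain ⟨t, ht⟩ := QuotientAddGroup.mk_surjective (z - c)
    exact ⟨t, congrArg g (eq_sub_iff_add_eq.1 ht)⟩
  · have h₁ := add_right_cancel (hinj h)
    rw [← sub_eq_zero, ← AddCircle.coe_sub, AddCircle.coe_eq_zero_iff] at h₁
    obtain ⟨n, hn⟩ := h₁
    rw [zsmul_one] at hn
    rw [← hn] at hst
    have : n = 0 := Int.abs_lt_one_iff.1 (by exact_mod_cast hst)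
    rw [this, Int.cast_zero] at hn
    linarith

lemma IsSimpleClosedCurve.isPathConnected {X : Type*} [TopologicalSpace X] {S : Set X}
    (hS : IsSimpleClosedCurve S) : IsPathConnected S := by
  obtain ⟨g, hg, -, rfl⟩ := hS.exists_range_eq
  obtain ⟨f, hf, -, h, -⟩ := hS.exists_periodic_param (mem_range_self 0)
  rw [← h]
  exact isPathConnected_range hf

lemma IsSimpleClosedCurve.preimage_val {X : Type*} [TopologicalSpace X] [T2Space X] {S N : Set X}
    (hS : IsSimpleClosedCurve S) (hSN : S ⊆ N) :
    IsSimpleClosedCurve ((↑) ⁻¹' S : Set N) := by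
  obtain ⟨g, hg, hinj, rfl⟩ := hS.exists_range_eq
  have hmem (t) : g t ∈ N := hSN (mem_range_self t)
  have := (hg.codRestrict hmem).isSimpleClosedCurve_range (hinj.codRestrict hmem)
  convert this
  ext ⟨x, hx⟩
  simp

lemma isArcWithEndpoints_iff {X : Type*} [TopologicalSpace X] [T2Space X] {A : Set X} {a b : X} :
    IsArcWithEndpoints A a b ↔ ∃ γ : Path a b, Function.Injective γ ∧ range γ = A := by
  constructor
  · rintro ⟨e, rfl, rfl⟩
    refine ⟨⟨⟨fun t => e t, by fun_prop⟩, rfl, rfl⟩, Subtype.val_injective.comp e.injective, ?_⟩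
    change range (Subtype.val ∘ e) = A
    rw [range_comp, e.surjective.range_eq, image_univ, Subtype.range_val]
  · rintro ⟨γ, hγ, rfl⟩
    exact ⟨(γ.continuous.isClosedEmbedding hγ).isEmbedding.toHomeomorph, γ.source, γ.target⟩

/-- The path traced by a function of a real variable on an interval. -/
lemma exists_injective_path_of_injOn {X : Type*} [TopologicalSpace X] {f : ℝ → X}
    (hf : Continuous f) {a b : ℝ} (hab : a < b) (hinj : InjOn f (Icc a b)) :
    ∃ γ : Path (f a) (f b), Function.Injective γ ∧ range γ = f '' Icc a b := by
  have hba : 0 < b - a := sub_pos.2 hab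
  have himg : range (fun t : I => (t : ℝ) * (b - a) + a) = Icc a b := by
    ext x
    constructor
    · rintro ⟨⟨t, h0, h1⟩, rfl⟩
      constructor
      · have := mul_nonneg h0 hba.le
        simpa using this
      · have := mul_le_of_le_one_left hba.le h1
        dsimp only
        linarith
    · rintro ⟨h₁, h₂⟩
      refine ⟨⟨(x - a) / (b - a), div_nonneg (by linarith) hba.le,
        (div_le_one hba).2 (by linarith)⟩, ?_⟩
      dsimp only
      field_simp
      ring
  refine ⟨⟨⟨fun t => f (t * (b - a) + a), by fun_prop⟩, by simp, by simp⟩, fun s t hst => ?_, ?_⟩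
  · have := hinj (himg ▸ mem_range_self s) (himg ▸ mem_range_self t) hst
    exact Subtype.ext (by simpa [hba.ne'] using this)
  · rw [← himg, ← range_comp]
    rfl

lemma isSimpleClosedCurve_union {X : Type*} [TopologicalSpace X] [T2Space X] {u v : X}
    {α : Path u v} {β : Path v u} (hα : Function.Injective α) (hβ : Function.Injective β)
    (h : range α ∩ range β ⊆ {u, v}) : IsSimpleClosedCurve (range α ∪ range β) := by
  set f : ℝ → X := ⇑(α.trans β).extend with hf
  have hfc : Continuous f := (α.trans β).continuous_extend
  have hf01 : f 0 = f 1 := by simp [f]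
  have key (s t : I) (ht : t ≠ 1) (hs₂ : (s : ℝ) ≤ 1 / 2) (ht₂ : ¬ (t : ℝ) ≤ 1 / 2) :
      (α.trans β) s ≠ (α.trans β) t := by
    rw [Path.trans_apply, Path.trans_apply, dif_pos hs₂, dif_neg ht₂]
    intro heq
    rcases h ⟨⟨_, heq⟩, mem_range_self _⟩ with h | h
    · have := hβ (h.trans β.target.symm)
      rw [Subtype.ext_iff] at this
      refine ht (Subtype.ext ?_)
      simp only [Icc.coe_one] at this ⊢
      linarith
    · have := hβ (h.trans β.source.symm)
      rw [Subtype.ext_iff] at this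
      simp only [Icc.coe_zero] at this
      exact ht₂ (by linarith)
  have hinj (s t : I) (hs : s ≠ 1) (ht : t ≠ 1) (heq : (α.trans β) s = (α.trans β) t) :
      s = t := by
    by_cases hs₂ : (s : ℝ) ≤ 1 / 2 <;> by_cases ht₂ : (t : ℝ) ≤ 1 / 2
    · rw [Path.trans_apply, Path.trans_apply, dif_pos hs₂, dif_pos ht₂] at heq
      have := Subtype.ext_iff.1 (hα heq)
      exact Subtype.ext (by dsimp only at this; linarith)
    · exact absurd heq (key s t ht hs₂ ht₂)
    · exact absurd heq.symm (key t s hs ht₂ hs₂)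
    · rw [Path.trans_apply, Path.trans_apply, dif_neg hs₂, dif_neg ht₂] at heq
      have := Subtype.ext_iff.1 (hβ heq)
      exact Subtype.ext (by dsimp only at this; linarith)
  have hg : Continuous (AddCircle.liftIco 1 0 f) :=
    AddCircle.liftIco_zero_continuous hf01 hfc.continuousOn
  have hsurj (x : AddCircle (1 : ℝ)) : ∃ t ∈ Ico (0 : ℝ) 1, (t : AddCircle (1 : ℝ)) = x := by
    have := AddCircle.coe_image_Ico_eq (1 : ℝ) 0
    rw [zero_add] at this
    exact this.ge (mem_univ x)
  have hval {t : ℝ} (ht : t ∈ Ico (0 : ℝ) 1) : AddCircle.liftIco 1 0 f (t : AddCircle (1 : ℝ)) =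
      (α.trans β) ⟨t, Ico_subset_Icc_self ht⟩ := by
    rw [AddCircle.liftIco_zero_coe_apply ht, hf, Path.extend_apply _ (Ico_subset_Icc_self ht)]
  have hrange : range (AddCircle.liftIco 1 0 f) = range α ∪ range β := by
    rw [← Path.trans_range]
    refine Subset.antisymm ?_ ?_
    · rintro _ ⟨x, rfl⟩
      obtain ⟨t, ht, rfl⟩ := hsurj x
      rw [hval ht]
      exact mem_range_self _
    · rintro _ ⟨⟨t, ht⟩, rfl⟩
      rcases ht.2.lt_or_eq with h1 | rfl
      · exact ⟨t, hval ⟨ht.1, h1⟩⟩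
      · refine ⟨(0 : ℝ), (hval (by simp)).trans ?_⟩
        exact (α.trans β).source.trans (α.trans β).target.symm
  rw [← hrange]
  refine hg.isSimpleClosedCurve_range fun x y hxy => ?_
  obtain ⟨s, hs, rfl⟩ := hsurj x
  obtain ⟨t, ht, rfl⟩ := hsurj y
  rw [hval hs, hval ht] at hxy
  have := hinj _ _ (fun h => hs.2.ne (Subtype.ext_iff.1 h)) (fun h => ht.2.ne (Subtype.ext_iff.1 h))
    hxy
  rw [Subtype.mk.injEq] at this
  rw [this]

end Curves

section Joining

open Set Filter unitInterval

/-- An arc one of whose interior points can be bypassed contributes to a simple closed curve. -/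
lemma exists_isSimpleClosedCurve_of_joinedIn {X : Type*} [TopologicalSpace X]
    [TopologicalSpace.MetrizableSpace X] {p q d : X} {f : Path p q} (hf : Function.Injective f)
    {Z : Set X} (hd : d ∈ range f) (hdZ : d ∉ Z) (h : JoinedIn Z p q) :
    ∃ S, IsSimpleClosedCurve S ∧ d ∈ S ∧ S ⊆ range f ∪ Z := by
  obtain ⟨γ, hγ⟩ := h
  obtain ⟨c, rfl⟩ := hd
  have hRZ : range γ ⊆ Z := range_subset_iff.2 hγ
  have hclosed : IsClosed (f ⁻¹' range γ) :=
    (isCompact_range γ.continuous).isClosed.preimage f.continuous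
  obtain ⟨c₁, ⟨hc₁, hc₁R⟩, hc₁max⟩ : ∃ c₁, IsGreatest (Iic c ∩ f ⁻¹' range γ) c₁ :=
    (isClosed_Iic.inter hclosed).isCompact.exists_isGreatest
      ⟨0, unitInterval.nonneg c, 0, by simp⟩
  obtain ⟨c₂, ⟨hc₂, hc₂R⟩, hc₂min⟩ : ∃ c₂, IsLeast (Ici c ∩ f ⁻¹' range γ) c₂ :=
    (isClosed_Ici.inter hclosed).isCompact.exists_isLeast
      ⟨1, unitInterval.le_one c, 1, by simp⟩
  have hcR : f c ∉ range γ := fun h => hdZ (hRZ h)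
  have hlt₁ : c₁ < c := lt_of_le_of_ne hc₁ fun h => hcR (h ▸ hc₁R)
  have hlt₂ : c < c₂ := lt_of_le_of_ne hc₂ fun h => hcR (h ▸ hc₂R)
  have hlt : c₁ < c₂ := hlt₁.trans hlt₂
  obtain ⟨α, hα, hαr⟩ := exists_injective_path_of_injOn f.continuous_extend
    (a := c₁) (b := c₂) hlt (fun s hs t ht hst => by
      have hs' : s ∈ I := ⟨c₁.2.1.trans hs.1, hs.2.trans c₂.2.2⟩
      have ht' : t ∈ I := ⟨c₁.2.1.trans ht.1, ht.2.trans c₂.2.2⟩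
      rw [f.extend_apply hs', f.extend_apply ht'] at hst
      exact Subtype.ext_iff.1 (hf hst))
  have himg : f.extend '' Icc (c₁ : ℝ) c₂ = f '' Icc c₁ c₂ := by
    ext z
    constructor
    · rintro ⟨t, ht, rfl⟩
      have ht' : t ∈ I := ⟨c₁.2.1.trans ht.1, ht.2.trans c₂.2.2⟩
      exact ⟨⟨t, ht'⟩, ht, (f.extend_apply ht').symm⟩
    · rintro ⟨t, ht, rfl⟩
      exact ⟨t, ht, f.extend_extends' t⟩
  rw [himg] at hαr
  have h₁ : f.extend c₁ = f c₁ := f.extend_extends' c₁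
  have h₂ : f.extend c₂ = f c₂ := f.extend_extends' c₂
  have hjoin : JoinedIn (range γ) (f c₂) (f c₁) := by
    obtain ⟨s, hs⟩ := hc₂R
    obtain ⟨t, ht⟩ := hc₁R
    exact ⟨(γ.subpath s t).cast hs.symm ht.symm, fun u => ⟨_, rfl⟩⟩
  obtain ⟨β, hβ, hβr⟩ := hjoin.exists_injective_path fun h => hlt.ne' (hf h)
  refine ⟨_, isSimpleClosedCurve_union (α := α.cast h₁.symm h₂.symm) hα hβ ?_, ?_, ?_⟩
  · change range α ∩ range β ⊆ _
    rw [hαr]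
    rintro _ ⟨⟨t, ht, rfl⟩, htβ⟩
    rcases le_total t c with h | h
    · exact Or.inl (congrArg f ((hc₁max ⟨h, hβr htβ⟩).antisymm ht.1))
    · exact Or.inr (congrArg f (ht.2.antisymm (hc₂min ⟨h, hβr htβ⟩)))
  · exact Or.inl (hαr.ge ⟨c, ⟨hc₁, hc₂⟩, rfl⟩)
  · exact union_subset_union (hαr.le.trans (image_subset_range _ _)) (hβr.trans hRZ)

lemma IsOpen.exists_frontier_of_joinedIn {X : Type*} [TopologicalSpace X] {W F : Set X}
    (hW : IsOpen W) {s d : X} (h : JoinedIn F s d) (hs : s ∉ W) (hd : d ∈ W) :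
    ∃ p ∈ frontier W, JoinedIn (F \ W) s p := by
  obtain ⟨γ, hγ⟩ := h
  have hA : IsOpen (γ ⁻¹' W) := hW.preimage γ.continuous
  obtain ⟨t, ht, hmin⟩ : ∃ t, IsLeast (closure (γ ⁻¹' W)) t :=
    isClosed_closure.isCompact.exists_isLeast ⟨1, subset_closure (by simpa using hd)⟩
  have hlt (u : I) (hu : u < t) : γ u ∉ W := fun h => hu.not_ge (hmin (subset_closure h))
  have htW : γ t ∉ W := fun h => by
    have h0 : 0 < t := lt_of_le_of_ne t.2.1 fun h0 => hs (by
      have : γ 0 ∈ W := by rw [show (0 : I) = t from h0]; exact h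
      simpa using this)
    obtain ⟨l, hl, hlt'⟩ := exists_Ioc_subset_of_mem_nhds (hA.mem_nhds h) ⟨0, h0⟩
    obtain ⟨z, hz₁, hz₂⟩ := exists_between hl
    exact hlt z hz₂ (hlt' ⟨hz₁, hz₂.le⟩)
  refine ⟨γ t, ?_, ?_⟩
  · rw [hW.frontier_eq]
    exact ⟨γ.continuous.closure_preimage_subset W ht, htW⟩
  · refine ⟨(γ.subpath 0 t).cast γ.source.symm rfl, fun u => ?_⟩
    change γ.subpath 0 t u ∈ F \ W
    have hu : γ.subpath 0 t u ∈ γ '' Icc 0 t := by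
      rw [← γ.range_subpath_of_le 0 t t.2.1]
      exact mem_range_self u
    obtain ⟨v, hv, hvu⟩ := hu
    rw [← hvu]
    refine ⟨hγ v, ?_⟩
    rcases hv.2.lt_or_eq with h | rfl
    · exact hlt v h
    · exact htW

lemma Continuous.exists_first_exit {X : Type*} [TopologicalSpace X] {f : ℝ → X}
    (hf : Continuous f) {W : Set X} (hW : IsOpen W) {T : ℝ} (hT : 0 ≤ T) (h0 : f 0 ∈ W)
    (h1 : f T ∉ W) :
    ∃ t, 0 < t ∧ t ≤ T ∧ f t ∈ frontier W ∧ ∀ s, 0 ≤ s → s < t → f s ∈ W := by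
  have hc : IsClosed (f ⁻¹' Wᶜ) := hW.isClosed_compl.preimage hf
  obtain ⟨t, ⟨ht, htW⟩, hmin⟩ : ∃ t, IsLeast (Icc 0 T ∩ f ⁻¹' Wᶜ) t :=
    (isCompact_Icc.inter_right hc).exists_isLeast ⟨T, ⟨hT, le_rfl⟩, h1⟩
  have hlt (s : ℝ) (hs : 0 ≤ s) (hst : s < t) : f s ∈ W := by
    by_contra h
    exact hst.not_ge (hmin ⟨⟨hs, hst.le.trans ht.2⟩, h⟩)
  have ht0 : 0 < t := lt_of_le_of_ne ht.1 fun h => htW (h ▸ h0)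
  refine ⟨t, ht0, ht.2, ?_, hlt⟩
  rw [hW.frontier_eq]
  refine ⟨?_, htW⟩
  have : t ∈ closure (Ico 0 t) := by
    rw [closure_Ico ht0.ne]
    exact ⟨ht0.le, le_rfl⟩
  exact closure_mono (image_subset_iff.2 fun s hs => hlt s hs.1 hs.2)
    (image_closure_subset_closure_image hf ⟨t, this, rfl⟩)

lemma IsCompact.exists_cluster_pair {X : Type*} [TopologicalSpace X] {K T : Set X}
    (hK : IsCompact K) {x : X} (hx : x ∈ closure T) {P : X → X → X → Prop}
    (h : ∀ d ∈ T, ∃ p ∈ K, ∃ q ∈ K, P d p q) :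
    ∃ p ∈ K, ∃ q ∈ K, ∀ V ∈ 𝓝 p, ∀ V' ∈ 𝓝 q, ∀ U ∈ 𝓝 x,
      ∃ d ∈ U ∩ T, ∃ p' ∈ V, ∃ q' ∈ V', P d p' q' := by
  obtain ⟨u, hTu, hux⟩ := mem_closure_iff_ultrafilter.1 hx
  choose! p hp q hq hP using h
  have hpK : (u.map p : Filter X) ≤ 𝓟 K :=
    le_principal_iff.2 (Filter.mem_map.2 (mem_of_superset hTu hp))
  have hqK : (u.map q : Filter X) ≤ 𝓟 K :=
    le_principal_iff.2 (Filter.mem_map.2 (mem_of_superset hTu hq))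
  obtain ⟨p', hp', hup⟩ := hK.ultrafilter_le_nhds _ hpK
  obtain ⟨q', hq', huq⟩ := hK.ultrafilter_le_nhds _ hqK
  refine ⟨p', hp', q', hq', fun V hV V' hV' U hU => ?_⟩
  obtain ⟨d, ⟨⟨hdU, hdT⟩, hdV⟩, hdV'⟩ := u.nonempty_of_mem
    (inter_mem (inter_mem (inter_mem (hux hU) hTu) (hup hV)) (huq hV'))
  exact ⟨d, ⟨hdU, hdT⟩, p d, hdV, q d, hdV', hP d hdT⟩

end Joining

section LocalDendrite

open Set TopologicalSpace

lemma IsLocalDendrite.locallyConnectedSpace {X : Type*} [TopologicalSpace X]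
    (hX : IsLocalDendrite X) : LocallyConnectedSpace X := by
  rw [locallyConnectedSpace_iff_connected_subsets]
  intro x U hU
  obtain ⟨N, hN, -, hlc, -⟩ := hX.2 x
  obtain ⟨V, hV, hVc, hVU⟩ := locallyConnectedSpace_iff_connected_subsets.1 hlc
    ⟨x, mem_of_mem_nhds hN⟩ ((↑) ⁻¹' U) (continuous_subtype_val.continuousAt hU)
  refine ⟨(↑) '' V, ?_, hVc.image _ continuous_subtype_val.continuousOn, image_subset_iff.2 hVU⟩
  rw [← map_nhds_subtype_coe_eq_nhds (mem_of_mem_nhds hN) hN]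
  exact Filter.image_mem_map hV

end LocalDendrite

section CurveHull

open Set TopologicalSpace unitInterval

/-- The set of points lying on a simple closed curve. -/
def curvePoints (X : Type*) [TopologicalSpace X] : Set X :=
  {x | ∃ S, IsSimpleClosedCurve S ∧ x ∈ S}

/-- The union of all arcs whose endpoints lie on simple closed curves. -/
def curveHull (X : Type*) [TopologicalSpace X] : Set X :=
  ⋃₀ {A | ∃ a b, IsArcWithEndpoints A a b ∧ a ∈ curvePoints X ∧ b ∈ curvePoints X}

variable {X : Type*} [TopologicalSpace X]

lemma mem_curveHull_iff [T2Space X] {d : X} : d ∈ curveHull X ↔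
    ∃ a ∈ curvePoints X, ∃ b ∈ curvePoints X, ∃ γ : Path a b,
      Function.Injective γ ∧ d ∈ range γ := by
  constructor
  · rintro ⟨A, ⟨a, b, hA, ha, hb⟩, hd⟩
    obtain ⟨γ, hγ, rfl⟩ := isArcWithEndpoints_iff.1 hA
    exact ⟨a, ha, b, hb, γ, hγ, hd⟩
  · rintro ⟨a, ha, b, hb, γ, hγ, hd⟩
    exact ⟨_, ⟨a, b, isArcWithEndpoints_iff.2 ⟨γ, hγ, rfl⟩, ha, hb⟩, hd⟩

lemma curvePoints_subset_curveHull [T2Space X] : curvePoints X ⊆ curveHull X := by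
  rintro p ⟨S, hS, hp⟩
  obtain ⟨f, hf, rfl, rfl, -, hinj⟩ := hS.exists_periodic_param hp
  obtain ⟨γ, hγ, -⟩ := exists_injective_path_of_injOn hf (a := 0) (b := 1 / 2) (by norm_num)
    fun s hs t ht h => hinj s t (by
      rw [abs_lt]
      constructor <;> linarith [hs.1, hs.2, ht.1, ht.2]) h
  exact mem_curveHull_iff.2 ⟨_, ⟨_, hS, mem_range_self _⟩, _, ⟨_, hS, mem_range_self _⟩, γ, hγ,
    0, γ.source⟩

lemma joinedIn_curveHull [MetrizableSpace X] [PathConnectedSpace X] {a b : X}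
    (ha : a ∈ curvePoints X) (hb : b ∈ curvePoints X) : JoinedIn (curveHull X) a b := by
  by_cases hab : a = b
  · subst hab
    exact JoinedIn.refl (curvePoints_subset_curveHull ha)
  · obtain ⟨γ, hγ, -⟩ :=
      (joinedIn_univ.2 (PathConnectedSpace.joined a b)).exists_injective_path hab
    exact ⟨γ, fun t => mem_curveHull_iff.2 ⟨a, ha, b, hb, γ, hγ, mem_range_self t⟩⟩

lemma isPathConnected_curveHull [MetrizableSpace X] [PathConnectedSpace X]
    (h : (curvePoints X).Nonempty) : IsPathConnected (curveHull X) := by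
  obtain ⟨c, hc⟩ := h
  refine ⟨c, curvePoints_subset_curveHull hc, fun {d} hd => ?_⟩
  obtain ⟨a, ha, b, hb, γ, hγ, t, rfl⟩ := mem_curveHull_iff.1 hd
  refine (joinedIn_curveHull hc ha).trans ⟨(γ.subpath 0 t).cast γ.source.symm rfl, fun u => ?_⟩
  exact mem_curveHull_iff.2 ⟨a, ha, b, hb, γ, hγ, _, rfl⟩

/-- A point of the hull which lies on no simple closed curve separates two points which do. -/
lemma exists_not_joinedIn_compl [MetrizableSpace X] {d : X} (hd : d ∈ curveHull X)
    (hdc : d ∉ curvePoints X) :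
    ∃ a ∈ curvePoints X, ∃ b ∈ curvePoints X, ¬ JoinedIn {d}ᶜ a b := by
  obtain ⟨a, ha, b, hb, γ, hγ, hdγ⟩ := mem_curveHull_iff.1 hd
  refine ⟨a, ha, b, hb, fun h => hdc ?_⟩
  obtain ⟨S, hS, hdS, -⟩ := exists_isSimpleClosedCurve_of_joinedIn hγ hdγ (by simp) h
  exact ⟨S, hS, hdS⟩

lemma curveHull_subset [MetrizableSpace X] [LocallyPathConnectedSpace X] {Y : Set X}
    (hY : IsPreconnected Y) (h : curvePoints X ⊆ Y) : curveHull X ⊆ Y := by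
  intro d hd
  by_contra hdY
  obtain ⟨a, ha, b, hb, hab⟩ := exists_not_joinedIn_compl hd fun hdc => hdY (h hdc)
  have hYd : Y ⊆ {d}ᶜ := subset_compl_singleton_iff.2 hdY
  have hsub := hY.subset_connectedComponentIn (h ha) hYd
  have hconn : IsConnected (connectedComponentIn {d}ᶜ a) :=
    isConnected_connectedComponentIn_iff.2 (hYd (h ha))
  exact hab ((((isOpen_compl_singleton.connectedComponentIn.isConnected_iff_isPathConnected).1
    hconn).joinedIn _ (hsub (h ha)) _ (hsub (h hb))).mono (connectedComponentIn_subset _ _))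

/-- A simple closed curve through a point of an open set `W` which leaves a larger set `O`
contains an arc through this point with endpoints on the frontier of `W`. -/
lemma IsSimpleClosedCurve.exists_path_frontier {S W O : Set X} {d : X}
    (hS : IsSimpleClosedCurve S) (hd : d ∈ S) (hW : IsOpen W) (hdW : d ∈ W)
    (hWO : closure W ⊆ O) (hSO : ¬ S ⊆ O) :
    ∃ p ∈ frontier W, ∃ q ∈ frontier W, ∃ f : Path p q, Function.Injective f ∧
      range f ⊆ O ∩ S ∧ d ∈ range f := by
  obtain ⟨f, hf, rfl, rfl, hper, hinj⟩ := hS.exists_periodic_param hd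
  obtain ⟨_, ⟨t', rfl⟩, ht'⟩ := not_subset.1 hSO
  obtain ⟨t₀, ht₀, hlt, hft⟩ : ∃ t₀, 0 ≤ t₀ ∧ t₀ < 1 ∧ f t₀ ∉ O := by
    refine ⟨Int.fract t', Int.fract_nonneg _, Int.fract_lt_one _, ?_⟩
    have := hper.sub_int_mul_eq (x := t') ⌊t'⌋
    rw [mul_one] at this
    rwa [Int.fract, this]
  have hft' : f (t₀ - 1) ∉ O := by rwa [hper.sub_eq]
  obtain ⟨t₁, h₁0, h₁, h₁W, hlt₁⟩ := hf.exists_first_exit hW ht₀ hdW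
    fun h => hft (hWO (subset_closure h))
  obtain ⟨t₂, h₂0, h₂, h₂W, hlt₂⟩ := (hf.comp continuous_neg).exists_first_exit hW
    (T := 1 - t₀) (by linarith) (by simpa using hdW)
    fun h => hft' (hWO (subset_closure (by simpa using h)))
  simp only [Function.comp_apply] at h₂W hlt₂
  have hKO : frontier W ⊆ O := frontier_subset_closure.trans hWO
  have hne : t₁ < t₀ := lt_of_le_of_ne h₁ fun h => hft (h ▸ hKO h₁W)
  obtain ⟨γ, hγ, hr⟩ := exists_injective_path_of_injOn hf (a := -t₂) (b := t₁) (by linarith)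
    fun s hs t ht h => hinj s t (by
      rw [abs_lt]
      constructor <;> linarith [hs.1, hs.2, ht.1, ht.2]) h
  refine ⟨_, h₂W, _, h₁W, γ, hγ, ?_, hr.ge ⟨0, ⟨by linarith, h₁0.le⟩, rfl⟩⟩
  rw [hr]
  rintro _ ⟨t, ht, rfl⟩
  refine ⟨?_, mem_range_self t⟩
  rcases le_total 0 t with h | h
  · rcases ht.2.lt_or_eq with h' | rfl
    · exact hWO (subset_closure (hlt₁ t h h'))
    · exact hKO h₁W
  · rcases ht.1.lt_or_eq with h' | rfl
    · have := hlt₂ (-t) (by linarith) (by linarith)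
      rw [neg_neg] at this
      exact hWO (subset_closure this)
    · exact hKO h₂W

lemma exists_nested_open_nhds [T2Space X] [CompactSpace X] {x : X} {O : Set X} (hO : IsOpen O)
    (hx : x ∈ O) :
    ∃ W W', IsOpen W ∧ IsOpen W' ∧ x ∈ W' ∧ closure W' ⊆ W ∧ closure W ⊆ O := by
  obtain ⟨W, hW, hxW, hWO⟩ :=
    normal_exists_closure_subset isClosed_singleton hO (singleton_subset_iff.2 hx)
  obtain ⟨W', hW', hxW', hWW'⟩ := normal_exists_closure_subset isClosed_singleton hW hxW
  exact ⟨W, W', hW, hW', hxW' rfl, hWW', hWO⟩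

lemma notMem_closure_curvePoints [MetrizableSpace X] [CompactSpace X]
    [LocallyPathConnectedSpace X] {x : X} (hx : x ∉ curveHull X) {O : Set X} (hO : IsOpen O)
    (hxO : x ∈ O) (h : ∀ S ⊆ O, ¬ IsSimpleClosedCurve S) : x ∉ closure (curvePoints X) := by
  intro hcl
  obtain ⟨W, W', hW, hW', hxW', hWW', hWO⟩ := exists_nested_open_nhds hO hxO
  have hW'W : W' ⊆ W := subset_closure.trans hWW'
  have hexists : ∀ d ∈ W' ∩ curvePoints X, ∃ p ∈ frontier W, ∃ q ∈ frontier W,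
      ∃ f : Path p q, Function.Injective f ∧ range f ⊆ O ∩ {x}ᶜ ∧ d ∈ range f := by
    rintro d ⟨hdW, S, hS, hdS⟩
    obtain ⟨p, hp, q, hq, f, hf, hfS, hd⟩ :=
      hS.exists_path_frontier hdS hW (hW'W hdW) hWO fun hSO => h S hSO hS
    refine ⟨p, hp, q, hq, f, hf, hfS.trans (inter_subset_inter_right _ ?_), hd⟩
    exact subset_compl_singleton_iff.2 fun hxS =>
      hx (curvePoints_subset_curveHull ⟨S, hS, hxS⟩)
  obtain ⟨p, hp, q, hq, hpq⟩ := isClosed_frontier.isCompact.exists_cluster_pair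
    (hW'.inter_closure ⟨hxW', hcl⟩) hexists
  have hKG : frontier W ⊆ O ∩ (closure W')ᶜ := fun z hz =>
    ⟨hWO (frontier_subset_closure hz), fun h => (hW.frontier_eq ▸ hz).2 (hWW' h)⟩
  have hG : IsOpen (O ∩ (closure W')ᶜ) := hO.inter isClosed_closure.isOpen_compl
  obtain ⟨V, hV, hVc, hVG⟩ := (pathConnected_subset_basis hG (hKG hp)).ex_mem
  obtain ⟨V', hV', hVc', hVG'⟩ := (pathConnected_subset_basis hG (hKG hq)).ex_mem
  obtain ⟨-, -, p₁, hp₁, q₁, hq₁, f₁, -, hf₁, -⟩ := hpq V hV V' hV' univ Filter.univ_mem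
  have hU : (range f₁)ᶜ ∈ 𝓝 x :=
    (isCompact_range f₁.continuous).isClosed.isOpen_compl.mem_nhds fun h => (hf₁ h).2 rfl
  obtain ⟨d, ⟨hdf, hdW', -⟩, p₂, hp₂, q₂, hq₂, f₂, hinj, hf₂, hd⟩ := hpq V hV V' hV' _ hU
  have hjoin₁ : JoinedIn (range f₁) p₁ q₁ := ⟨f₁, mem_range_self⟩
  have hjoin : JoinedIn (V ∪ range f₁ ∪ V') p₂ q₂ :=
    (((hVc.joinedIn _ hp₂ _ hp₁).mono (subset_union_left.trans subset_union_left)).trans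
      (hjoin₁.mono (subset_union_right.trans subset_union_left))).trans
      ((hVc'.joinedIn _ hq₁ _ hq₂).mono subset_union_right)
  have hdZ : d ∉ V ∪ range f₁ ∪ V' := by
    rintro ((hdV | hdf') | hdV)
    · exact (hVG hdV).2 (subset_closure hdW')
    · exact hdf hdf'
    · exact (hVG' hdV).2 (subset_closure hdW')
  obtain ⟨S, hS, -, hSsub⟩ := exists_isSimpleClosedCurve_of_joinedIn hinj hd hdZ hjoin
  refine h S (hSsub.trans (union_subset (hf₂.trans inter_subset_left) (union_subset
    (union_subset ?_ (hf₁.trans inter_subset_left)) ?_))) hS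
  exacts [hVG.trans inter_subset_left, hVG'.trans inter_subset_left]

lemma notMem_closure_curveHull_diff [MetrizableSpace X] [CompactSpace X] [PathConnectedSpace X]
    [LocallyPathConnectedSpace X] {x : X} (hx : x ∉ curveHull X) {O : Set X} (hO : IsOpen O)
    (hxO : x ∈ O) (h : ∀ S ⊆ O, ¬ IsSimpleClosedCurve S) :
    x ∉ closure (curveHull X \ curvePoints X) := by
  intro hcl
  obtain ⟨c, hc⟩ : (curvePoints X).Nonempty := by
    obtain ⟨d, hd, -⟩ := closure_nonempty_iff.1 ⟨x, hcl⟩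
    obtain ⟨a, ha, -⟩ := mem_curveHull_iff.1 hd
    exact ⟨a, ha⟩
  obtain ⟨W, W', hW, hW', hxW', hWW', hWO⟩ := exists_nested_open_nhds hO hxO
  have hW'W : W' ⊆ W := subset_closure.trans hWW'
  have hDx : curveHull X ⊆ {x}ᶜ := subset_compl_singleton_iff.2 hx
  set C := pathComponentIn {x}ᶜ c
  have hCx : C ⊆ {x}ᶜ := pathComponentIn_subset
  have hCc : IsPathConnected C :=
    isPathConnected_pathComponentIn (hDx (curvePoints_subset_curveHull hc))
  have hCP : curvePoints X ⊆ C := fun a ha => (joinedIn_curveHull hc ha).mono hDx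
  have hexists : ∀ d ∈ W' ∩ (curveHull X \ curvePoints X), ∃ p ∈ frontier W, ∃ q ∈ frontier W,
      ∃ a b, ¬ JoinedIn (C \ {d}) a b ∧ JoinedIn (C \ {d}) a p ∧ JoinedIn (C \ {d}) b q := by
    rintro d ⟨hdW, hd, hdc⟩
    obtain ⟨a, ha, b, hb, hab⟩ := exists_not_joinedIn_compl hd hdc
    have hdC : d ∈ C := by
      by_contra hdC
      exact hab ((hCc.joinedIn _ (hCP ha) _ (hCP hb)).mono (subset_compl_singleton_iff.2 hdC))
    have hfr (a : X) (ha : a ∈ curvePoints X) :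
        ∃ p ∈ frontier W, JoinedIn (C \ {d}) a p := by
      obtain ⟨S, hS, haS⟩ := ha
      obtain ⟨s, hsS, hsO⟩ := not_subset.1 fun hSO => h S hSO hS
      have hSP : S ⊆ curvePoints X := fun z hz => ⟨S, hS, hz⟩
      have hSC : S ⊆ C \ {d} :=
        subset_sdiff_singleton (hSP.trans hCP) fun hdS => hdc (hSP hdS)
      obtain ⟨p, hp, hsp⟩ := hW.exists_frontier_of_joinedIn
        (hCc.joinedIn _ (hSC hsS).1 _ hdC) (fun hsW => hsO (hWO (subset_closure hsW))) (hW'W hdW)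
      exact ⟨p, hp, ((hS.isPathConnected.joinedIn _ haS _ hsS).mono hSC).trans
        (hsp.mono (sdiff_subset_sdiff_right (singleton_subset_iff.2 (hW'W hdW))))⟩
    obtain ⟨p, hp, hap⟩ := hfr a ha
    obtain ⟨q, hq, hbq⟩ := hfr b hb
    exact ⟨p, hp, q, hq, a, b, fun h => hab (h.mono fun z hz => hz.2), hap, hbq⟩
  obtain ⟨p, hp, q, hq, hpq⟩ := isClosed_frontier.isCompact.exists_cluster_pair
    (hW'.inter_closure ⟨hxW', hcl⟩) hexists
  have hKG : frontier W ⊆ (closure W')ᶜ := fun z hz h => (hW.frontier_eq ▸ hz).2 (hWW' h)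
  have hG : IsOpen (closure W')ᶜ := isClosed_closure.isOpen_compl
  obtain ⟨V, hV, hVc, hVG⟩ := (pathConnected_subset_basis hG (hKG hp)).ex_mem
  obtain ⟨V', hV', hVc', hVG'⟩ := (pathConnected_subset_basis hG (hKG hq)).ex_mem
  obtain ⟨d₁, -, p₁, hp₁, q₁, hq₁, a₁, b₁, -, hap₁, hbq₁⟩ :=
    hpq V hV V' hV' univ Filter.univ_mem
  have hp₁C := hap₁.target_mem.1
  have hq₁C := hbq₁.target_mem.1
  have hsub {U : Set X} {z : X} (hUc : IsPathConnected U) (hUG : U ⊆ (closure W')ᶜ) (hz : z ∈ U)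
      (hzC : z ∈ C) {d : X} (hd : d ∈ W') : U ⊆ C \ {d} := by
    refine subset_sdiff_singleton (fun w hw => ?_) fun hdU => hUG hdU (subset_closure hd)
    exact JoinedIn.trans hzC ((hUc.joinedIn _ hz _ hw).mono
      (subset_compl_singleton_iff.2 fun hxU => hUG hxU (subset_closure hxW')))
  obtain ⟨γ, hγ⟩ := hCc.joinedIn _ hp₁C _ hq₁C
  have hU : (range γ)ᶜ ∈ 𝓝 x := (isCompact_range γ.continuous).isClosed.isOpen_compl.mem_nhds
    fun ⟨t, ht⟩ => hCx (hγ t) ht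
  obtain ⟨d, ⟨hdγ, hdW', -⟩, p₂, hp₂, q₂, hq₂, a, b, hab, hap, hbq⟩ := hpq V hV V' hV' _ hU
  have hγd : JoinedIn (C \ {d}) p₁ q₁ := ⟨γ, fun t => ⟨hγ t, fun h => hdγ ⟨t, h⟩⟩⟩
  exact hab ((((hap.trans ((hVc.joinedIn _ hp₂ _ hp₁).mono (hsub hVc hVG hp₁ hp₁C hdW'))).trans
    hγd).trans ((hVc'.joinedIn _ hq₁ _ hq₂).mono (hsub hVc' hVG' hq₁ hq₁C hdW'))).trans hbq.symm)

lemma IsLocalDendrite.isClosed_curveHull [MetrizableSpace X] [CompactSpace X]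
    [PathConnectedSpace X] [LocallyPathConnectedSpace X] (hX : IsLocalDendrite X) :
    IsClosed (curveHull X) := by
  refine isClosed_of_closure_subset fun x hcl => ?_
  by_contra hx
  obtain ⟨N, hN, -, -, hNS⟩ := hX.2 x
  have hS : ∀ S ⊆ interior N, ¬ IsSimpleClosedCurve S := fun S hSN hS =>
    hNS _ (hS.preimage_val (hSN.trans interior_subset))
  have hxN := mem_interior_iff_mem_nhds.2 hN
  rw [← union_sdiff_cancel (curvePoints_subset_curveHull (X := X)), closure_union] at hcl
  exact hcl.elim (notMem_closure_curvePoints hx isOpen_interior hxN hS)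
    (notMem_closure_curveHull_diff hx isOpen_interior hxN hS)

end CurveHull

/-- In a local dendrite `X` containing a simple closed curve, the union `D`
of all arcs both of whose endpoints lie on simple closed curves is the smallest
subcontinuum of `X` containing all the simple closed curves. -/
theorem union_of_arcs_is_smallest_subcontinuum
    {X : Type u} [TopologicalSpace X] (hX : IsLocalDendrite X)
    (hscc : ∃ S : Set X, IsSimpleClosedCurve S)
    (D : Set X)
    (hD : D = ⋃₀ {A : Set X | ∃ a b : X, IsArcWithEndpoints A a b ∧
        (∃ S : Set X, IsSimpleClosedCurve S ∧ a ∈ S) ∧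
        (∃ S : Set X, IsSimpleClosedCurve S ∧ b ∈ S)}) :
    IsContinuum D ∧
    (∀ S : Set X, IsSimpleClosedCurve S → S ⊆ D) ∧
    (∀ Y : Set X, IsContinuum Y → (∀ S : Set X, IsSimpleClosedCurve S → S ⊆ Y) →
      D ⊆ Y) := by
  replace hD : D = curveHull X := hD
  subst hD
  obtain ⟨-, hcompact, hconn, hmetr⟩ := hX.1
  have := hX.locallyConnectedSpace
  have := LocallyConnectedSpace.locallyPathConnectedSpace (X := X)
  have := PathConnectedSpace.of_locallyPathConnectedSpace (X := X)
  have hne : (curvePoints X).Nonempty := by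
    obtain ⟨S, hS⟩ := hscc
    exact hS.isPathConnected.nonempty.mono fun z hz => ⟨S, hS, hz⟩
  have hDc := (isPathConnected_curveHull hne).isConnected
  refine ⟨⟨hDc.nonempty.to_subtype, isCompact_iff_compactSpace.1 hX.isClosed_curveHull.isCompact,
    isConnected_iff_connectedSpace.1 hDc, inferInstance⟩, fun S hS z hz =>
    curvePoints_subset_curveHull ⟨S, hS, hz⟩, fun Y hY h => ?_⟩
  exact curveHull_subset (isConnected_iff_connectedSpace.2 hY.2.2.1).isPreconnected
    fun z ⟨S, hS, hz⟩ => h S hS hz
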